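/- For every x in the Cuntz algebra O_n (n ≥ 2), the scalar multiple φ_n(x)·1 of the identity lies in the norm closure of the convex hull of {u x u* : u a unitary in F_n}. (Archbold's Dixmier-type averaging property for O_n relative to F_n.) -/

import Mathlib

open scoped ComplexOrder

/-- The word `S_μ = S_{μ₁} ⋯ S_{μ_k}` associated to a multi-index `μ`. -/
def cuntzWord {A : Type*} [Monoid A] {n : ℕ} (S : Fin n → A) (μ : List (Fin n)) : A :=
  (μ.map S).prod

/-- `F_n^k`: the C*-subalgebra generated by the words `S_μ S_ν*` with `|μ| = |ν| = k`. -/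
def cuntzFnk {A : Type*} [CStarAlgebra A] {n : ℕ} (S : Fin n → A) (k : ℕ) :
    StarSubalgebra ℂ A :=
  (StarAlgebra.adjoin ℂ {x : A | ∃ μ ν : List (Fin n),
    μ.length = k ∧ ν.length = k ∧ x = cuntzWord S μ * star (cuntzWord S ν)}).topologicalClosure

/-- `F_n`: the C*-subalgebra generated by all the words `S_μ S_ν*` with `|μ| = |ν|`. -/
def cuntzFn {A : Type*} [CStarAlgebra A] {n : ℕ} (S : Fin n → A) : StarSubalgebra ℂ A :=
  (StarAlgebra.adjoin ℂ {x : A | ∃ μ ν : List (Fin n),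
    μ.length = ν.length ∧ x = cuntzWord S μ * star (cuntzWord S ν)}).topologicalClosure

/-- A state on a C*-algebra: a positive continuous linear functional of norm one. -/
def IsState {A : Type*} [CStarAlgebra A] (f : A →L[ℂ] ℂ) : Prop :=
  ‖f‖ = 1 ∧ ∀ a : A, 0 ≤ f (star a * a)

/-- The defining property of the canonical state `φ_n` on `O_n`:
`φ_n(S_μ S_ν*) = n^{-|μ|} δ_{μν}`. -/
def IsCuntzState {A : Type*} [CStarAlgebra A] {n : ℕ} (S : Fin n → A)
    (φ : A →L[ℂ] ℂ) : Prop :=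
  IsState φ ∧ ∀ μ ν : List (Fin n),
    φ (cuntzWord S μ * star (cuntzWord S ν)) =
      if μ = ν then ((n : ℂ) ^ μ.length)⁻¹ else 0

/-- A finite family of isometries with pairwise orthogonal ranges summing to the identity. -/
structure IsCuntzFamily {ι A : Type*} [Fintype ι] [DecidableEq ι] [CStarAlgebra A]
    (S : ι → A) : Prop where
  star_mul : ∀ i j, star (S i) * S j = if i = j then 1 else 0
  sum_mul_star : ∑ i, S i * star (S i) = 1

/-- Isometries whose range projections sum to `1` have pairwise orthogonal ranges. -/
theorem IsCuntzFamily.of_isometries {ι A : Type*} [Fintype ι] [DecidableEq ι] [CStarAlgebra A]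
    {S : ι → A} (hiso : ∀ i, star (S i) * S i = 1) (hsum : ∑ i, S i * star (S i) = 1) :
    IsCuntzFamily S := by
  refine ⟨fun i j => ?_, hsum⟩
  split_ifs with hij
  · rw [hij, hiso]
  let _ : PartialOrder A := CStarAlgebra.spectralOrder A
  have : StarOrderedRing A := CStarAlgebra.spectralOrderedRing A
  have h1 : ∑ k, (star (S i) * S k) * star (star (S i) * S k) = 1 := by
    calc ∑ k, (star (S i) * S k) * star (star (S i) * S k)
        = star (S i) * (∑ k, S k * star (S k)) * S i := by
          simp [Finset.mul_sum, Finset.sum_mul, mul_assoc]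
      _ = 1 := by rw [hsum, mul_one, hiso]
  rw [← Finset.add_sum_erase _ _ (Finset.mem_univ i), hiso, star_one, mul_one,
    add_eq_left, Finset.sum_eq_zero_iff_of_nonneg (fun k _ => mul_star_self_nonneg _)] at h1
  exact CStarRing.mul_star_self_eq_zero_iff _ |>.1
    (h1 j (Finset.mem_erase.2 ⟨Ne.symm hij, Finset.mem_univ j⟩))

/-- The canonical endomorphism `y ↦ ∑ S_i y S_i*`. -/
def IsCuntzFamily.endomorphism {ι A : Type*} [Fintype ι] [DecidableEq ι] [CStarAlgebra A]
    {S : ι → A} (hS : IsCuntzFamily S) : A →⋆ₐ[ℂ] A where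
  toFun y := ∑ i, S i * y * star (S i)
  map_one' := by simpa using hS.sum_mul_star
  map_mul' x y := by
    have h (i j : ι) : S i * x * star (S i) * (S j * y * star (S j)) =
        if i = j then S i * (x * y) * star (S i) else 0 := by
      calc S i * x * star (S i) * (S j * y * star (S j))
          = S i * x * (star (S i) * S j) * (y * star (S j)) := by simp only [mul_assoc]
        _ = _ := by
          rw [hS.star_mul]
          split_ifs with hij
          · subst hij; simp only [mul_assoc, one_mul]
          · simp
    simp only [Finset.sum_mul, Finset.mul_sum, h]
    rw [Finset.sum_comm]
    simp
  map_zero' := by simp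
  map_add' x y := by simp [mul_add, add_mul, Finset.sum_add_distrib]
  commutes' r := by
    simp only [Algebra.algebraMap_eq_smul_one, mul_smul_comm, smul_mul_assoc, mul_one,
      ← Finset.smul_sum, hS.sum_mul_star]
  map_star' x := by simp [mul_assoc]

/-- The averaged left inverse `y ↦ n⁻¹ ∑ S_i* y S_i` of the canonical endomorphism. -/
noncomputable def cuntzTransfer {ι A : Type*} [Fintype ι] [CStarAlgebra A] (S : ι → A) :
    A →ₗ[ℂ] A :=
  (Fintype.card ι : ℂ)⁻¹ •
    ∑ i, LinearMap.mulLeft ℂ (star (S i)) ∘ₗ LinearMap.mulRight ℂ (S i)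

theorem cuntzTransfer_apply {ι A : Type*} [Fintype ι] [CStarAlgebra A] (S : ι → A) (x : A) :
    cuntzTransfer S x = (Fintype.card ι : ℂ)⁻¹ • ∑ i, star (S i) * x * S i := by
  simp [cuntzTransfer, mul_assoc]

theorem cuntzTransfer_star {ι A : Type*} [Fintype ι] [CStarAlgebra A] (S : ι → A) (x : A) :
    cuntzTransfer S (star x) = star (cuntzTransfer S x) := by
  simp [cuntzTransfer_apply, mul_assoc]

theorem norm_cuntzTransfer_le {ι A : Type*} [Fintype ι] [CStarAlgebra A] {S : ι → A}
    (hiso : ∀ i, star (S i) * S i = 1) (x : A) : ‖cuntzTransfer S x‖ ≤ ‖x‖ := by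
  have hS (i : ι) : ‖S i‖ ≤ 1 := by
    nontriviality A
    have h := CStarRing.norm_star_mul_self (x := S i)
    rw [hiso, CStarRing.norm_one] at h
    nlinarith [norm_nonneg (S i)]
  have hterm (i : ι) : ‖star (S i) * x * S i‖ ≤ ‖x‖ := by
    calc ‖star (S i) * x * S i‖ ≤ ‖star (S i)‖ * ‖x‖ * ‖S i‖ := norm_mul₃_le
      _ ≤ 1 * ‖x‖ * 1 := by
        rw [norm_star]
        gcongr <;> exact hS i
      _ = ‖x‖ := by ring
  rw [cuntzTransfer_apply, norm_smul, norm_inv, Complex.norm_natCast]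
  calc (Fintype.card ι : ℝ)⁻¹ * ‖∑ i, star (S i) * x * S i‖
      ≤ (Fintype.card ι : ℝ)⁻¹ * (Fintype.card ι * ‖x‖) := by
        gcongr
        simpa using norm_sum_le_of_le Finset.univ fun i _ => hterm i
    _ ≤ ‖x‖ := by
        rw [← mul_assoc]
        exact mul_le_of_le_one_left (norm_nonneg x) inv_mul_le_one

theorem norm_cuntzTransfer_pow_le {ι A : Type*} [Fintype ι] [CStarAlgebra A] {S : ι → A}
    (hiso : ∀ i, star (S i) * S i = 1) (m : ℕ) (x : A) : ‖(cuntzTransfer S ^ m) x‖ ≤ ‖x‖ := by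
  induction m generalizing x with
  | zero => simp
  | succ m ih =>
    rw [pow_succ, Module.End.mul_apply]
    exact (ih _).trans (norm_cuntzTransfer_le hiso x)

section Words

variable {A : Type*} [CStarAlgebra A] {n : ℕ} {S : Fin n → A}

theorem cuntzWord_cons (S : Fin n → A) (i : Fin n) (μ : List (Fin n)) :
    cuntzWord S (i :: μ) = S i * cuntzWord S μ := by
  simp [cuntzWord]

theorem cuntzWord_append (S : Fin n → A) (μ ν : List (Fin n)) :
    cuntzWord S (μ ++ ν) = cuntzWord S μ * cuntzWord S ν := by
  simp [cuntzWord]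

theorem cuntzTransfer_one (hn : n ≠ 0) (hS : IsCuntzFamily S) : cuntzTransfer S 1 = 1 := by
  have : (n : ℂ) ≠ 0 := by exact_mod_cast hn
  have hsum : ∑ i, star (S i) * 1 * S i = (n : ℂ) • (1 : A) := by
    simp [hS.star_mul, Nat.cast_smul_eq_nsmul]
  rw [cuntzTransfer_apply, hsum, Fintype.card_fin, smul_smul, inv_mul_cancel₀ this, one_smul]

theorem cuntzTransfer_mul_left (hS : IsCuntzFamily S) (i : Fin n) (x : A) :
    cuntzTransfer S (S i * x) = (n : ℂ)⁻¹ • (x * S i) := by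
  simp [cuntzTransfer_apply, ← mul_assoc, hS.star_mul]

theorem cuntzTransfer_conj (hS : IsCuntzFamily S) (i j : Fin n) (x : A) :
    cuntzTransfer S (S i * x * star (S j)) = if i = j then (n : ℂ)⁻¹ • x else 0 := by
  rw [mul_assoc, cuntzTransfer_mul_left hS, mul_assoc, hS.star_mul]
  by_cases h : i = j
  · simp [h]
  · simp [h, Ne.symm h]

theorem exists_cuntzTransfer_pow_word_eq (hS : IsCuntzFamily S) (m : ℕ) (μ : List (Fin n))
    (hμ : μ ≠ []) : ∃ ν : List (Fin n),
      (cuntzTransfer S ^ m) (cuntzWord S μ) = ((n : ℂ)⁻¹) ^ m • cuntzWord S ν := by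
  induction m generalizing μ with
  | zero => exact ⟨μ, by simp⟩
  | succ m ih =>
    obtain ⟨i, μ, rfl⟩ := List.exists_cons_of_ne_nil hμ
    obtain ⟨ν, hν⟩ := ih (μ ++ [i]) (by simp)
    refine ⟨ν, ?_⟩
    have : cuntzWord S μ * S i = cuntzWord S (μ ++ [i]) := by
      rw [cuntzWord_append]; simp [cuntzWord]
    rw [pow_succ, Module.End.mul_apply, cuntzWord_cons, cuntzTransfer_mul_left hS, this,
      map_smul, hν, smul_smul, pow_succ']

theorem norm_cuntzWord_le (hiso : ∀ i, star (S i) * S i = 1) (μ : List (Fin n)) :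
    ‖cuntzWord S μ‖ ≤ 1 := by
  nontriviality A
  have h1 : star (cuntzWord S μ) * cuntzWord S μ = 1 := by
    induction μ with
    | nil => simp [cuntzWord]
    | cons i μ ih =>
      rw [cuntzWord_cons, star_mul, mul_assoc, ← mul_assoc (star (S i)), hiso, one_mul, ih]
  have h := CStarRing.norm_star_mul_self (x := cuntzWord S μ)
  rw [h1, CStarRing.norm_one] at h
  nlinarith [norm_nonneg (cuntzWord S μ)]

theorem tendsto_cuntzTransfer_pow_word (hn : 2 ≤ n) (hS : IsCuntzFamily S) {μ : List (Fin n)}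
    (hμ : μ ≠ []) :
    Filter.Tendsto (fun m => (cuntzTransfer S ^ m) (cuntzWord S μ)) Filter.atTop (nhds 0) := by
  have hn' : (2 : ℝ) ≤ n := by exact_mod_cast hn
  have hlim : Filter.Tendsto (fun m => ((n : ℝ)⁻¹) ^ m) Filter.atTop (nhds 0) :=
    tendsto_pow_atTop_nhds_zero_of_lt_one (by positivity) (inv_lt_one_of_one_lt₀ (by linarith))
  refine squeeze_zero_norm (fun m => ?_) hlim
  obtain ⟨ν, hν⟩ := exists_cuntzTransfer_pow_word_eq hS m μ hμ
  rw [hν, norm_smul, norm_pow, norm_inv, Complex.norm_natCast]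
  exact mul_le_of_le_one_right (by positivity)
    (norm_cuntzWord_le (fun i => by simpa using hS.star_mul i i) ν)

theorem cuntzTransfer_pow_star (m : ℕ) (x : A) :
    (cuntzTransfer S ^ m) (star x) = star ((cuntzTransfer S ^ m) x) := by
  induction m generalizing x with
  | zero => simp
  | succ m ih => rw [pow_succ, Module.End.mul_apply, cuntzTransfer_star, ih,
      Module.End.mul_apply]

theorem tendsto_cuntzTransfer_pow_word_mul_star (hn : 2 ≤ n) (hS : IsCuntzFamily S)
    (μ ν : List (Fin n)) :
    Filter.Tendsto (fun m => (cuntzTransfer S ^ m) (cuntzWord S μ * star (cuntzWord S ν)))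
      Filter.atTop (nhds ((if μ = ν then ((n : ℂ) ^ μ.length)⁻¹ else 0) • 1)) := by
  have hnil : cuntzWord S [] = 1 := by simp [cuntzWord]
  induction μ generalizing ν with
  | nil =>
    cases ν with
    | nil =>
      have h (m : ℕ) : (cuntzTransfer S ^ m) 1 = 1 := by
        induction m with
        | zero => simp
        | succ m ih => rw [pow_succ, Module.End.mul_apply, cuntzTransfer_one (by omega) hS, ih]
      simp [hnil, h]
    | cons j ν =>
      simpa [hnil, cuntzTransfer_pow_star] using
        (tendsto_cuntzTransfer_pow_word hn hS (List.cons_ne_nil j ν)).star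
  | cons i μ ih =>
    cases ν with
    | nil =>
      simpa [hnil] using tendsto_cuntzTransfer_pow_word hn hS (List.cons_ne_nil i μ)
    | cons j ν =>
      rw [← Filter.tendsto_add_atTop_iff_nat 1]
      have h : cuntzTransfer S (cuntzWord S (i :: μ) * star (cuntzWord S (j :: ν))) =
          if i = j then (n : ℂ)⁻¹ • (cuntzWord S μ * star (cuntzWord S ν)) else 0 := by
        rw [← cuntzTransfer_conj hS]
        simp only [cuntzWord_cons, star_mul, mul_assoc]
      simp only [pow_succ, Module.End.mul_apply, h]
      by_cases hij : i = j
      · subst hij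
        have := (ih ν).const_smul (n : ℂ)⁻¹
        by_cases hμν : μ = ν
        · subst hμν
          simpa [smul_smul, pow_succ, mul_comm] using this
        · simpa [hμν] using this
      · simp [hij]

/-- The elements `S_μ S_ν*` span the star-algebra generated by the `S_i`. -/
theorem adjoin_le_span_words (hS : IsCuntzFamily S) {x : A}
    (hx : x ∈ StarAlgebra.adjoin ℂ (Set.range S)) :
    x ∈ Submodule.span ℂ {y : A | ∃ μ ν : List (Fin n),
      y = cuntzWord S μ * star (cuntzWord S ν)} := by
  set W := Submodule.span ℂ {y : A | ∃ μ ν : List (Fin n),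
    y = cuntzWord S μ * star (cuntzWord S ν)} with hW
  have hword (μ ν : List (Fin n)) : cuntzWord S μ * star (cuntzWord S ν) ∈ W :=
    Submodule.subset_span ⟨μ, ν, rfl⟩
  have hmul (a : A) (ha : ∀ μ ν, a * (cuntzWord S μ * star (cuntzWord S ν)) ∈ W)
      (w : A) (hw : w ∈ W) : a * w ∈ W := by
    induction hw using Submodule.span_induction with
    | mem w hw => obtain ⟨μ, ν, rfl⟩ := hw; exact ha μ ν
    | zero => simp
    | add x y _ _ hx hy => rw [mul_add]; exact W.add_mem hx hy
    | smul c x _ hx => rw [mul_smul_comm]; exact W.smul_mem c hx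
  have hgen (i : Fin n) (w : A) (hw : w ∈ W) : S i * w ∈ W := by
    refine hmul _ (fun μ ν => ?_) w hw
    rw [← mul_assoc, ← cuntzWord_cons]
    exact hword _ _
  have hgen_star (i : Fin n) (w : A) (hw : w ∈ W) : star (S i) * w ∈ W := by
    refine hmul _ (fun μ ν => ?_) w hw
    cases μ with
    | nil =>
      have h := hword [] (ν ++ [i])
      rw [cuntzWord_append] at h
      simpa [cuntzWord] using h
    | cons j μ =>
      rw [cuntzWord_cons, ← mul_assoc, ← mul_assoc, hS.star_mul]
      split_ifs
      · rw [one_mul]; exact hword _ _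
      · simp
  have key : ∀ w ∈ W, x * w ∈ W := by
    rw [← StarSubalgebra.mem_toSubalgebra, StarAlgebra.adjoin_toSubalgebra] at hx
    induction hx using Algebra.adjoin_induction with
    | mem a ha =>
      rcases ha with ⟨i, rfl⟩ | ⟨i, hi⟩
      · exact hgen i
      · rw [← star_star a, ← hi]; exact hgen_star i
    | algebraMap r =>
      intro w hw
      rw [← Algebra.smul_def]
      exact W.smul_mem r hw
    | add a b _ _ ha hb =>
      intro w hw
      rw [add_mul]
      exact W.add_mem (ha w hw) (hb w hw)
    | mul a b _ _ ha hb =>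
      intro w hw
      rw [mul_assoc]
      exact ha _ (hb w hw)
  have h1 : (1 : A) ∈ W := by simpa [cuntzWord] using hword [] []
  simpa using key 1 h1

theorem tendsto_cuntzTransfer_pow (hn : 2 ≤ n) (hS : IsCuntzFamily S)
    (hgen : (StarAlgebra.adjoin ℂ (Set.range S)).topologicalClosure = ⊤)
    {φ : A →L[ℂ] ℂ} (hφ : ∀ μ ν : List (Fin n), φ (cuntzWord S μ * star (cuntzWord S ν)) =
      if μ = ν then ((n : ℂ) ^ μ.length)⁻¹ else 0) (x : A) :
    Filter.Tendsto (fun m => (cuntzTransfer S ^ m) x) Filter.atTop (nhds (φ x • 1)) := by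
  have hspan (y : A) (hy : y ∈ Submodule.span ℂ {y : A | ∃ μ ν : List (Fin n),
      y = cuntzWord S μ * star (cuntzWord S ν)}) :
      Filter.Tendsto (fun m => (cuntzTransfer S ^ m) y) Filter.atTop (nhds (φ y • 1)) := by
    induction hy using Submodule.span_induction with
    | mem y hy =>
      obtain ⟨μ, ν, rfl⟩ := hy
      rw [hφ]
      exact tendsto_cuntzTransfer_pow_word_mul_star hn hS μ ν
    | zero => simp
    | add y z _ _ hy hz => simpa [add_smul] using hy.add hz
    | smul c y _ hy => simpa [smul_smul] using hy.const_smul c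
  have hdense : x ∈ closure (StarAlgebra.adjoin ℂ (Set.range S) : Set A) := by
    rw [← StarSubalgebra.topologicalClosure_coe, hgen]
    trivial
  have hcont : Continuous fun y : A => φ y • (1 : A) := by fun_prop
  rw [Metric.tendsto_atTop]
  intro ε hε
  obtain ⟨δ, hδ, hφδ⟩ := Metric.continuous_iff.1 hcont x (ε / 3) (by positivity)
  obtain ⟨y, hy, hxy⟩ := Metric.mem_closure_iff.1 hdense (min δ (ε / 3)) (by positivity)
  obtain ⟨N, hN⟩ := Metric.tendsto_atTop.1 (hspan y (adjoin_le_span_words hS hy)) (ε / 3)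
    (by positivity)
  refine ⟨N, fun m hm => ?_⟩
  have h1 : dist ((cuntzTransfer S ^ m) x) ((cuntzTransfer S ^ m) y) ≤ dist x y := by
    rw [dist_eq_norm, dist_eq_norm, ← map_sub]
    exact norm_cuntzTransfer_pow_le (fun i => by simpa using hS.star_mul i i) m _
  have h2 := hφδ y (by rw [dist_comm]; exact hxy.trans_le (min_le_left _ _))
  have h3 := hN m hm
  have h4 := hxy.trans_le (min_le_right _ _)
  have h5 := dist_triangle4 ((cuntzTransfer S ^ m) x) ((cuntzTransfer S ^ m) y)
    (φ y • (1 : A)) (φ x • (1 : A))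
  linarith

/-- The canonical endomorphism maps `F_n` into itself. -/
theorem endomorphism_mem_cuntzFn (hS : IsCuntzFamily S) {x : A} (hx : x ∈ cuntzFn S) :
    hS.endomorphism x ∈ cuntzFn S := by
  have hcont : Continuous hS.endomorphism :=
    AddMonoidHomClass.continuous_of_bound hS.endomorphism 1 fun y => by
      simpa using NonUnitalStarAlgHom.norm_apply_le hS.endomorphism y
  have hsub : StarAlgebra.adjoin ℂ {x : A | ∃ μ ν : List (Fin n),
      μ.length = ν.length ∧ x = cuntzWord S μ * star (cuntzWord S ν)} ≤
      (cuntzFn S).comap hS.endomorphism := by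
    refine StarAlgebra.adjoin_le ?_
    rintro _ ⟨μ, ν, hμν, rfl⟩
    change ∑ i, S i * (cuntzWord S μ * star (cuntzWord S ν)) * star (S i) ∈ cuntzFn S
    refine sum_mem fun i _ => ?_
    refine StarSubalgebra.le_topologicalClosure _ (StarAlgebra.subset_adjoin _ _
      ⟨i :: μ, i :: ν, by simpa using hμν, ?_⟩)
    simp only [cuntzWord_cons, star_mul, mul_assoc]
  exact StarSubalgebra.topologicalClosure_minimal hsub
    ((StarSubalgebra.isClosed_topologicalClosure _).preimage hcont) hx

end Words

section Orbit

variable {A : Type*} [CStarAlgebra A]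

/-- The orbit of `x` under conjugation by the unitaries of `B`. -/
def unitaryOrbit (B : StarSubalgebra ℂ A) (x : A) : Set A :=
  {y : A | ∃ u : A, u ∈ B ∧ u * star u = 1 ∧ star u * u = 1 ∧ y = u * x * star u}

/-- If a star-endomorphism preserving `B` sends `x` into the convex hull of the orbit of `z`,
then it sends the convex hull of the orbit of `x` there as well. -/
theorem map_mem_convexHull_unitaryOrbit {B : StarSubalgebra ℂ A} (f : A →⋆ₐ[ℂ] A)
    (hf : ∀ u ∈ B, f u ∈ B) {x y z : A} (hy : y ∈ convexHull ℝ (unitaryOrbit B x))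
    (hx : f x ∈ convexHull ℝ (unitaryOrbit B z)) :
    f y ∈ convexHull ℝ (unitaryOrbit B z) := by
  let g (v : A) : A →ₗ[ℝ] A :=
    ((LinearMap.mulLeft ℂ v) ∘ₗ (LinearMap.mulRight ℂ (star v))).restrictScalars ℝ
  have hg (v : A) (hv : v ∈ B) (h1 : v * star v = 1) (h2 : star v * v = 1) (w : A)
      (hw : w ∈ convexHull ℝ (unitaryOrbit B z)) :
      g v w ∈ convexHull ℝ (unitaryOrbit B z) := by
    have : convexHull ℝ (unitaryOrbit B z) ⊆ g v ⁻¹' convexHull ℝ (unitaryOrbit B z) := by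
      refine convexHull_min ?_ ((convex_convexHull ℝ _).linear_preimage (g v))
      rintro _ ⟨u, hu, hu1, hu2, rfl⟩
      refine subset_convexHull ℝ _ ⟨v * u, B.mul_mem hv hu, ?_, ?_, ?_⟩
      · rw [star_mul, mul_assoc, ← mul_assoc u, hu1, one_mul, h1]
      · rw [star_mul, mul_assoc, ← mul_assoc (star v), h2, one_mul, hu2]
      · simp [g, mul_assoc]
    exact this hw
  have hsub : convexHull ℝ (unitaryOrbit B x) ⊆
      (f.toAlgHom.toLinearMap.restrictScalars ℝ) ⁻¹' convexHull ℝ (unitaryOrbit B z) := by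
    refine convexHull_min ?_ ((convex_convexHull ℝ _).linear_preimage _)
    rintro _ ⟨u, hu, hu1, hu2, rfl⟩
    have h := hg (f u) (hf u hu) (by rw [← map_star, ← map_mul, hu1, map_one])
      (by rw [← map_star, ← map_mul, hu2, map_one]) (f x) hx
    simpa [g, mul_assoc, map_star] using h
  exact hsub hy

/-- Averaging over the conjugations by generalised permutation unitaries
`∑ₐ ψ(a h) T_{a+g} T_a*`, with `ψ` a primitive additive character. -/
theorem endomorphism_cuntzTransfer_mem_convexHull_zmod {n : ℕ} [NeZero n] {T : ZMod n → A}
    (hT : IsCuntzFamily T) {B : StarSubalgebra ℂ A} (hB : ∀ a b, T a * star (T b) ∈ B) (x : A) :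
    hT.endomorphism (cuntzTransfer T x) ∈ convexHull ℝ (unitaryOrbit B x) := by
  classical
  let ψ : AddChar (ZMod n) ℂ := ZMod.stdAddChar
  let u (g h : ZMod n) : A := ∑ a, ψ (a * h) • (T (a + g) * star (T a))
  have hψ (a : ZMod n) : star (ψ a) = ψ (-a) := (AddChar.map_neg_eq_conj ψ a).symm
  have hψ' (a : ZMod n) : ψ a * ψ (-a) = 1 := by
    rw [← AddChar.map_add_eq_mul, add_neg_cancel, AddChar.map_zero_eq_one]
  have hψ'' (a : ZMod n) : ψ (-a) * ψ a = 1 := by rw [mul_comm, hψ']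
  have hstar (g h : ZMod n) : star (u g h) = ∑ a, ψ (-(a * h)) • (T a * star (T (a + g))) := by
    simp [u, star_sum, hψ]
  have hmid (a b c d : ZMod n) : T a * star (T b) * (T c * star (T d)) =
      if b = c then T a * star (T d) else 0 := by
    calc T a * star (T b) * (T c * star (T d)) = T a * (star (T b) * T c) * star (T d) := by
          simp only [mul_assoc]
      _ = _ := by rw [hT.star_mul]; split_ifs <;> simp
  have hshift (g : ZMod n) : ∑ a, T (a + g) * star (T (a + g)) = 1 := by
    rw [← hT.sum_mul_star]
    exact Equiv.sum_comp (Equiv.addRight g) fun a => T a * star (T a)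
  have hu (g h : ZMod n) : u g h * x * star (u g h) ∈ unitaryOrbit B x := by
    refine ⟨u g h, B.sum_mem fun a _ => B.smul_mem (hB _ _) _, ?_, ?_, rfl⟩
    · rw [hstar]
      simp only [u, Finset.sum_mul, Finset.mul_sum, smul_mul_assoc, mul_smul_comm, hmid,
        smul_ite, smul_zero]
      simp [smul_smul, hψ'', hshift]
    · rw [hstar]
      simp only [u, Finset.sum_mul, Finset.mul_sum, smul_mul_assoc, mul_smul_comm, hmid,
        smul_ite, smul_zero, add_left_inj]
      simp [smul_smul, hψ', hT.sum_mul_star]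
  have hn : (n : ℂ) ≠ 0 := by exact_mod_cast NeZero.ne n
  have hconj (g : ZMod n) : ∑ h, u g h * x * star (u g h) =
      (n : ℂ) • ∑ a, T (a + g) * (star (T a) * x * T a) * star (T (a + g)) := by
    have hterm (h : ZMod n) : u g h * x * star (u g h) = ∑ a, ∑ b,
        ψ (h * (a - b)) • (T (a + g) * (star (T a) * x * T b) * star (T (b + g))) := by
      rw [hstar]
      simp only [u, Finset.sum_mul, Finset.mul_sum, smul_mul_assoc, mul_smul_comm,
        Finset.smul_sum, smul_smul]
      rw [Finset.sum_comm]
      refine Finset.sum_congr rfl fun a _ => Finset.sum_congr rfl fun b _ => ?_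
      rw [← AddChar.map_add_eq_mul]
      congr 1
      · congr 1; ring
      · simp only [mul_assoc]
    simp only [hterm]
    rw [Finset.sum_comm, Finset.smul_sum]
    refine Finset.sum_congr rfl fun a _ => ?_
    rw [Finset.sum_comm]
    simp only [← Finset.sum_smul, ψ,
      AddChar.sum_mulShift _ (ZMod.isPrimitive_stdAddChar n), sub_eq_zero]
    simp [ZMod.card]
  have hsum : hT.endomorphism (cuntzTransfer T x) =
      ∑ p : ZMod n × ZMod n, ((n : ℝ) ^ 2)⁻¹ • (u p.1 p.2 * x * star (u p.1 p.2)) := by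
    have hreal (y : A) : ((n : ℝ) ^ 2)⁻¹ • y = ((n : ℂ) ^ 2)⁻¹ • y := by
      rw [← Complex.coe_smul]; simp
    rw [← Finset.smul_sum, hreal, Fintype.sum_prod_type]
    simp only [hconj]
    rw [← Finset.smul_sum, smul_smul, Finset.sum_comm]
    have hinner (a : ZMod n) :
        ∑ g, T (a + g) * (star (T a) * x * T a) * star (T (a + g)) =
          hT.endomorphism (star (T a) * x * T a) :=
      Equiv.sum_comp (Equiv.addLeft a) fun c => T c * (star (T a) * x * T a) * star (T c)
    simp only [hinner]
    rw [cuntzTransfer_apply, map_smul, map_sum, ZMod.card]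
    congr 1
    field_simp
  rw [hsum]
  refine (convex_convexHull ℝ _).sum_mem (fun _ _ => by positivity) ?_
    fun p _ => subset_convexHull ℝ _ (hu p.1 p.2)
  have hn' : (n : ℝ) ≠ 0 := by exact_mod_cast NeZero.ne n
  simp [ZMod.card]
  field_simp

end Orbit

theorem endomorphism_cuntzTransfer_mem_convexHull {A : Type*} [CStarAlgebra A] {n : ℕ}
    (hn : n ≠ 0) {S : Fin n → A} (hS : IsCuntzFamily S) (x : A) :
    hS.endomorphism (cuntzTransfer S x) ∈ convexHull ℝ (unitaryOrbit (cuntzFn S) x) := by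
  obtain ⟨m, rfl⟩ := Nat.exists_eq_succ_of_ne_zero hn
  have hmem (a b : Fin (m + 1)) : S a * star (S b) ∈ cuntzFn S :=
    StarSubalgebra.le_topologicalClosure _ (StarAlgebra.subset_adjoin _ _
      ⟨[a], [b], rfl, by simp [cuntzWord]⟩)
  exact endomorphism_cuntzTransfer_mem_convexHull_zmod (n := m + 1) (T := S) hS hmem x

theorem iterate_endomorphism_cuntzTransfer_mem_convexHull {A : Type*} [CStarAlgebra A] {n : ℕ}
    (hn : n ≠ 0) {S : Fin n → A} (hS : IsCuntzFamily S) (m : ℕ) (x : A) :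
    hS.endomorphism^[m] ((cuntzTransfer S ^ m) x) ∈
      convexHull ℝ (unitaryOrbit (cuntzFn S) x) := by
  induction m generalizing x with
  | zero =>
    exact subset_convexHull ℝ _ ⟨1, one_mem _, by simp, by simp, by simp⟩
  | succ m ih =>
    rw [Function.iterate_succ_apply', pow_succ, Module.End.mul_apply]
    exact map_mem_convexHull_unitaryOrbit _ (fun u => endomorphism_mem_cuntzFn hS)
      (ih (cuntzTransfer S x)) (endomorphism_cuntzTransfer_mem_convexHull hn hS x)

/-- **(Archbold)** Dixmier-type averaging property for `O_n` relative to `F_n`: for every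
`x ∈ O_n`, the scalar `φ_n(x)·1` lies in the norm closure of the convex hull of
`{u x u* : u unitary in F_n}`. -/
theorem cuntz_dixmier_property {A : Type*} [CStarAlgebra A] {n : ℕ} (hn : 2 ≤ n)
    (S : Fin n → A)
    (hiso : ∀ i, star (S i) * S i = 1)
    (hsum : ∑ i, S i * star (S i) = 1)
    (hgen : (StarAlgebra.adjoin ℂ (Set.range S)).topologicalClosure = ⊤)
    (φ : A →L[ℂ] ℂ) (hφ : IsCuntzState S φ) (x : A) :
    φ x • (1 : A) ∈ closure (convexHull ℝ
      {y : A | ∃ u : A, u ∈ cuntzFn S ∧ u * star u = 1 ∧ star u * u = 1 ∧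
        y = u * x * star u}) := by
  have hS := IsCuntzFamily.of_isometries hiso hsum
  rw [Metric.mem_closure_iff]
  intro ε hε
  obtain ⟨m, hm⟩ := ((Metric.tendsto_nhds.1
    (tendsto_cuntzTransfer_pow hn hS hgen hφ.2 x)) ε hε).exists
  refine ⟨_, iterate_endomorphism_cuntzTransfer_mem_convexHull (by omega) hS m x, ?_⟩
  have hbound (k : ℕ) (y : A) :
      dist (φ x • (1 : A)) (hS.endomorphism^[k] y) ≤ dist (φ x • (1 : A)) y := by
    induction k with
    | zero => simp
    | succ k ih =>
      rw [Function.iterate_succ_apply']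
      refine le_trans ?_ ih
      have h : φ x • (1 : A) = hS.endomorphism (φ x • 1) := by rw [map_smul, map_one]
      conv_lhs => rw [h]
      rw [dist_eq_norm, dist_eq_norm, ← map_sub]
      exact NonUnitalStarAlgHom.norm_apply_le hS.endomorphism _
  exact (hbound m _).trans_lt (by rwa [dist_comm])
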